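/- Assume 0 < r ≤ σ₁² ≤ σ₂², and let c be the unique zero of G in (−1, ∞). Then the function x ↦ ψ(x)/(1+x)² is strictly decreasing on (−1, c); in particular, for every x with −1 < x < c one has ψ(x)·(1+c)² ≥ ψ(c)·(1+x)². -/

import Mathlib

open Real Filter Set

/-- The increasing fundamental solution ψ for the oscillating Brownian motion with
volatility `σ₁` on `(-∞,0)` and `σ₂` on `(0,∞)`, discount parameter `r`. -/
noncomputable def psi (σ₁ σ₂ r x : ℝ) : ℝ :=
  if x < 0 then Real.exp (Real.sqrt (2*r)/σ₁ * x)
  else (1 + σ₂/σ₁)/2 * Real.exp (Real.sqrt (2*r)/σ₂ * x)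
     + (1 - σ₂/σ₁)/2 * Real.exp (-(Real.sqrt (2*r)/σ₂) * x)

/-- G(x) = ψ′(x)·(1+x)² − 2·ψ(x)·(1+x). -/
noncomputable def Gfun (σ₁ σ₂ r x : ℝ) : ℝ :=
  deriv (psi σ₁ σ₂ r) x * (1 + x)^2 - 2 * psi σ₁ σ₂ r x * (1 + x)

/-- Gluing two differentiable functions whose values and derivatives agree at the junction. -/
lemma hasDerivAt_ite_lt {f g f' g' : ℝ → ℝ} {a : ℝ} (hf : ∀ x, HasDerivAt f (f' x) x)
    (hg : ∀ x, HasDerivAt g (g' x) x) (h : f a = g a) (h' : f' a = g' a) (x : ℝ) :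
    HasDerivAt (fun x => if x < a then f x else g x) (if x < a then f' x else g' x) x := by
  rcases lt_trichotomy x a with hx | rfl | hx
  · rw [if_pos hx]
    refine (hf x).congr_of_eventuallyEq ?_
    filter_upwards [Iio_mem_nhds hx] with y hy
    exact if_pos hy
  · rw [if_neg (lt_irrefl x), ← hasDerivWithinAt_univ, ← Iic_union_Ici (a := x)]
    refine HasDerivWithinAt.union ?_ ?_
    · refine (h' ▸ (hf x).hasDerivWithinAt).congr (fun y hy => ?_) ?_
      · rcases (mem_Iic.mp hy).lt_or_eq with hy | rfl
        · exact if_pos hy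
        · simp [h]
      · simp [h]
    · exact (hg x).hasDerivWithinAt.congr (fun y hy => if_neg (not_lt.mpr hy))
        (if_neg (lt_irrefl x))
  · rw [if_neg hx.not_gt]
    refine (hg x).congr_of_eventuallyEq ?_
    filter_upwards [Ioi_mem_nhds hx] with y hy
    exact if_neg (lt_asymm hy)

lemma hasDerivAt_exp_const_mul (k x : ℝ) :
    HasDerivAt (fun x => Real.exp (k * x)) (k * Real.exp (k * x)) x := by
  simpa [mul_comm] using ((hasDerivAt_id x).const_mul k).exp

/-- The derivative of `psi`. -/
noncomputable def psiDeriv (σ₁ σ₂ r x : ℝ) : ℝ :=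
  if x < 0 then √(2 * r) / σ₁ * Real.exp (√(2 * r) / σ₁ * x)
  else (1 + σ₂ / σ₁) / 2 * (√(2 * r) / σ₂ * Real.exp (√(2 * r) / σ₂ * x))
    + (1 - σ₂ / σ₁) / 2 * (-(√(2 * r) / σ₂) * Real.exp (-(√(2 * r) / σ₂) * x))

lemma psiDeriv_junction {σ₂ : ℝ} (σ₁ r : ℝ) (hσ₂ : σ₂ ≠ 0) :
    √(2 * r) / σ₁ * Real.exp (√(2 * r) / σ₁ * 0) =
      (1 + σ₂ / σ₁) / 2 * (√(2 * r) / σ₂ * Real.exp (√(2 * r) / σ₂ * 0))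
      + (1 - σ₂ / σ₁) / 2 * (-(√(2 * r) / σ₂) * Real.exp (-(√(2 * r) / σ₂) * 0)) := by
  simp only [mul_zero, Real.exp_zero, mul_one]
  field_simp
  ring

lemma hasDerivAt_psi {σ₂ : ℝ} (σ₁ r : ℝ) (hσ₂ : σ₂ ≠ 0) (x : ℝ) :
    HasDerivAt (psi σ₁ σ₂ r) (psiDeriv σ₁ σ₂ r x) x := by
  refine hasDerivAt_ite_lt (a := 0) (fun x => hasDerivAt_exp_const_mul _ x)
    (fun x => ((hasDerivAt_exp_const_mul _ x).const_mul _).add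
      ((hasDerivAt_exp_const_mul _ x).const_mul _)) ?_ (psiDeriv_junction σ₁ r hσ₂) x
  simp only [mul_zero, Real.exp_zero, mul_one, Pi.add_apply]
  ring

lemma continuous_psiDeriv {σ₂ : ℝ} (σ₁ r : ℝ) (hσ₂ : σ₂ ≠ 0) :
    Continuous (psiDeriv σ₁ σ₂ r) := by
  refine Continuous.if (fun a ha => ?_) (by fun_prop) (by fun_prop)
  obtain rfl : a = 0 := by
    change a ∈ frontier (Iio 0) at ha
    rwa [frontier_Iio] at ha
  exact psiDeriv_junction σ₁ r hσ₂

lemma continuous_Gfun {σ₂ : ℝ} (σ₁ r : ℝ) (hσ₂ : σ₂ ≠ 0) : Continuous (Gfun σ₁ σ₂ r) := by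
  have hψ : Continuous (psi σ₁ σ₂ r) :=
    continuous_iff_continuousAt.mpr fun x => (hasDerivAt_psi σ₁ r hσ₂ x).continuousAt
  have hψ' : Continuous (deriv (psi σ₁ σ₂ r)) := by
    rw [funext fun x => (hasDerivAt_psi σ₁ r hσ₂ x).deriv]
    exact continuous_psiDeriv σ₁ r hσ₂
  unfold Gfun
  fun_prop

lemma Gfun_neg_of_lt {σ₁ σ₂ r x : ℝ} (hσ₂ : σ₂ ≠ 0) (hx : -1 < x) (hx0 : x < 0)
    (h : √(2 * r) / σ₁ * (1 + x) < 2) : Gfun σ₁ σ₂ r x < 0 := by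
  have hG : Gfun σ₁ σ₂ r x = Real.exp (√(2 * r) / σ₁ * x) * (1 + x)
      * (√(2 * r) / σ₁ * (1 + x) - 2) := by
    rw [Gfun, (hasDerivAt_psi σ₁ r hσ₂ x).deriv, psiDeriv, psi, if_pos hx0, if_pos hx0]
    ring
  rw [hG]
  exact mul_neg_of_pos_of_neg (mul_pos (Real.exp_pos _) (by linarith)) (by linarith)

/-- `Gfun` is negative to the left of any point below which it has no zero in `(-1, ∞)`. -/
lemma Gfun_neg_of_forall_ne_zero {σ₁ σ₂ r c x : ℝ} (hσ₂ : σ₂ ≠ 0)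
    (hne : ∀ y ∈ Ioo (-1) c, Gfun σ₁ σ₂ r y ≠ 0) (hx : x ∈ Ioo (-1) c) :
    Gfun σ₁ σ₂ r x < 0 := by
  have hlim : Tendsto (fun y : ℝ => √(2 * r) / σ₁ * (1 + y)) (nhdsWithin (-1) (Ioi (-1)))
      (nhds 0) := by
    have : Continuous fun y : ℝ => √(2 * r) / σ₁ * (1 + y) := by fun_prop
    simpa using (this.tendsto (-1)).mono_left nhdsWithin_le_nhds
  obtain ⟨y, hy, hyx, hy0⟩ := ((hlim.eventually_lt_const two_pos).and
    (inter_mem (Ioo_mem_nhdsGT hx.1) (Ioo_mem_nhdsGT neg_one_lt_zero))).exists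
  have hGy := Gfun_neg_of_lt hσ₂ hyx.1 hy0.2 hy
  by_contra! hGx
  obtain ⟨z, hz, hGz⟩ := intermediate_value_Icc hyx.2.le
    (continuous_Gfun σ₁ r hσ₂).continuousOn ⟨hGy.le, hGx⟩
  exact hne z ⟨hyx.1.trans_le hz.1, hz.2.trans_lt hx.2⟩ hGz

lemma hasDerivAt_psi_div_sq {σ₂ x : ℝ} (σ₁ r : ℝ) (hσ₂ : σ₂ ≠ 0) (hx : 1 + x ≠ 0) :
    HasDerivAt (fun x => psi σ₁ σ₂ r x / (1 + x) ^ 2) (Gfun σ₁ σ₂ r x / ((1 + x) ^ 2) ^ 2) x := by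
  have hψ := hasDerivAt_psi σ₁ r hσ₂ x
  refine (hψ.div (((hasDerivAt_id x).const_add 1).pow 2) (pow_ne_zero 2 hx)).congr_deriv ?_
  rw [Gfun, hψ.deriv]
  simp
  ring

lemma strictAntiOn_psi_div_sq {σ₁ σ₂ r c : ℝ} (hσ₂ : σ₂ ≠ 0)
    (hne : ∀ y ∈ Ioo (-1) c, Gfun σ₁ σ₂ r y ≠ 0) :
    StrictAntiOn (fun x => psi σ₁ σ₂ r x / (1 + x) ^ 2) (Ioc (-1) c) := by
  have hd : ∀ x : ℝ, -1 < x → HasDerivAt (fun x => psi σ₁ σ₂ r x / (1 + x) ^ 2)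
      (Gfun σ₁ σ₂ r x / ((1 + x) ^ 2) ^ 2) x := fun x hx =>
    hasDerivAt_psi_div_sq σ₁ r hσ₂ (by linarith)
  refine strictAntiOn_of_deriv_neg (convex_Ioc _ _)
    (fun x hx => (hd x hx.1).continuousAt.continuousWithinAt) fun x hx => ?_
  rw [interior_Ioc] at hx
  rw [(hd x hx.1).deriv]
  have : 0 < 1 + x := by linarith [hx.1]
  exact div_neg_of_neg_of_pos (Gfun_neg_of_forall_ne_zero hσ₂ hne hx) (by positivity)

/-- Assume 0 < r ≤ σ₁² ≤ σ₂² and let c be the unique zero of G in (−1,∞). Then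
x ↦ ψ(x)/(1+x)² is strictly decreasing on (−1,c); in particular
ψ(x)·(1+c)² ≥ ψ(c)·(1+x)² for −1 < x < c. -/
theorem stmt_9 (σ₁ σ₂ r : ℝ) (hσ₁ : 0 < σ₁) (hσ₂ : 0 < σ₂) (hr : 0 < r)
    (hr1 : r ≤ σ₁^2) (h12 : σ₁^2 ≤ σ₂^2)
    (c : ℝ) (hc : -1 < c) (hc0 : Gfun σ₁ σ₂ r c = 0)
    (huniq : ∀ y : ℝ, -1 < y → Gfun σ₁ σ₂ r y = 0 → y = c) :
    StrictAntiOn (fun x => psi σ₁ σ₂ r x / (1 + x)^2) (Set.Ioo (-1) c) ∧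
    (∀ x : ℝ, -1 < x → x < c →
      psi σ₁ σ₂ r c * (1 + x)^2 ≤ psi σ₁ σ₂ r x * (1 + c)^2) := by
  have hanti := strictAntiOn_psi_div_sq (c := c) hσ₂.ne'
    fun y hy hGy => hy.2.ne (huniq y hy.1 hGy)
  refine ⟨hanti.mono Ioo_subset_Ioc_self, fun x hx hxc => ?_⟩
  have hx' : 0 < 1 + x := by linarith
  have hc' : 0 < 1 + c := by linarith
  have h := (hanti ⟨hx, hxc.le⟩ ⟨hc, le_rfl⟩ hxc).le
  exact (div_le_div_iff₀ (by positivity) (by positivity)).mp h
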